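/- Let α be a real number with 0 ≤ α < 3/2. There exists a constant C (depending only on α) such that for every s > 0 and every x ∈ ℝ³ with x ≠ 0, (2πs)^{−3/2} ∫_{ℝ³} |x − y|^{−2α} e^{−|y|²/(2s)} dy ≤ C |x|^{−2α}. -/

import Mathlib

open MeasureTheory in
theorem aux_g (α : ℝ) (hα : α < 3 / 2) :
    Integrable ((Metric.ball (0 : EuclideanSpace ℝ (Fin 3)) 1).indicator
      (fun z => ‖z‖ ^ (-(2 * α)))) := by
  rw [integrable_indicator_iff Metric.isOpen_ball.measurableSet]
  refine integrableOn_ball_of_norm_le_rpow (C := 1) (α := 2 * α) (by simp) (by simp; linarith) ?_ ?_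
  · refine Filter.Eventually.of_forall fun z => ?_
    rw [Real.norm_of_nonneg (by positivity)]
    simp
  · exact (measurable_norm.pow_const _).aestronglyMeasurable

theorem aux_v (r s : ℝ) (hr : 0 < r) (hs : 0 < s) :
    (2 * Real.pi * s) ^ (-(3 / 2) : ℝ) * r ^ 3 * Real.exp (-r ^ 2 / (2 * s)) ≤ 3 := by
  have hpi := Real.pi_gt_three
  set v := r ^ 2 / (2 * Real.pi * s) with hv
  have hv0 : 0 < v := by positivity
  have hvu : v ≤ r ^ 2 / (2 * s) := by
    rw [hv]
    gcongr
    nlinarith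
  have h1 : (2 * Real.pi * s) ^ (-(3 / 2) : ℝ) * r ^ 3 = v ^ (3 / 2 : ℝ) := by
    rw [hv, Real.div_rpow (by positivity) (by positivity), Real.rpow_neg (by positivity),
      ← Real.rpow_natCast r 2, ← Real.rpow_mul hr.le, ← Real.rpow_natCast r 3]
    norm_num
    field_simp
  have h2 : v ^ (3 / 2 : ℝ) ≤ 1 + v ^ 2 := by
    rcases le_total v 1 with h | h
    · have := Real.rpow_le_one hv0.le h (by norm_num : (0 : ℝ) ≤ 3 / 2)
      nlinarith
    · have := Real.rpow_le_rpow_of_exponent_le h (by norm_num : (3 / 2 : ℝ) ≤ (2 : ℕ))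
      rw [Real.rpow_natCast] at this
      linarith
  have h3 := Real.quadratic_le_exp_of_nonneg hv0.le
  have h4 := Real.exp_le_exp.2 hvu
  rw [h1, neg_div, Real.exp_neg, ← div_eq_mul_inv, div_le_iff₀ (Real.exp_pos _)]
  nlinarith

open MeasureTheory in
theorem stmt9 (α : ℝ) (hα0 : 0 ≤ α) (hα : α < 3 / 2) :
    ∃ C : ℝ, ∀ s : ℝ, 0 < s → ∀ x : EuclideanSpace ℝ (Fin 3), x ≠ 0 →
      (2 * Real.pi * s) ^ (-(3 / 2) : ℝ) *
          ∫ y : EuclideanSpace ℝ (Fin 3),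
            ‖x - y‖ ^ (-(2 * α)) * Real.exp (-‖y‖ ^ 2 / (2 * s))
        ≤ C * ‖x‖ ^ (-(2 * α)) := by
  set g := ((Metric.ball (0 : EuclideanSpace ℝ (Fin 3)) 1).indicator
      (fun z => ‖z‖ ^ (-(2 * α)))) with hgdef
  have hg : Integrable g := aux_g α hα
  have hg0 : ∀ z, 0 ≤ g z := fun z => Set.indicator_nonneg (fun _ _ => by positivity) _
  have hK : 0 ≤ ∫ z, g z := integral_nonneg hg0
  set K := ∫ z, g z with hKdef
  refine ⟨(1 / 2 : ℝ) ^ (-(2 * α)) * (1 + 3 * K), fun s hs x hx => ?_⟩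
  have hxp : 0 < ‖x‖ := norm_pos_iff.2 hx
  set r := ‖x‖ * (1 / 2) with hr
  have hrp : 0 < r := by positivity
  have hgr : Integrable (fun y => g (r⁻¹ • (x - y))) :=
    (hg.comp_smul (inv_ne_zero hrp.ne')).comp_sub_left x
  have hgi : ∫ y, g (r⁻¹ • (x - y)) = r ^ 3 * K := by
    rw [integral_sub_left_eq_self (fun y => g (r⁻¹ • y)) volume x,
      Measure.integral_comp_inv_smul]
    simp [abs_of_pos hrp]
    exact Or.inl rfl
  have hE : ∀ y : EuclideanSpace ℝ (Fin 3),
      Real.exp (-‖y‖ ^ 2 / (2 * s)) = Real.exp (-(1 / (2 * s)) * ‖y‖ ^ 2) := fun y => by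
    congr 1; ring
  have hb : 0 < 1 / (2 * s) := by positivity
  have hei : ∫ y : EuclideanSpace ℝ (Fin 3), Real.exp (-‖y‖ ^ 2 / (2 * s))
      = (2 * Real.pi * s) ^ (3 / 2 : ℝ) := by
    simp_rw [hE]
    rw [GaussianFourier.integral_rexp_neg_mul_sq_norm hb]
    simp
    congr 1
    field_simp
  have heI : Integrable (fun y : EuclideanSpace ℝ (Fin 3) => Real.exp (-‖y‖ ^ 2 / (2 * s))) := by
    by_contra h
    rw [integral_undef h] at hei
    have : 0 < (2 * Real.pi * s) ^ (3 / 2 : ℝ) := by positivity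
    linarith
  have hpt : ∀ y, ‖x - y‖ ^ (-(2 * α)) * Real.exp (-‖y‖ ^ 2 / (2 * s)) ≤
      r ^ (-(2 * α)) * (Real.exp (-‖y‖ ^ 2 / (2 * s)) +
        Real.exp (-r ^ 2 / (2 * s)) * g (r⁻¹ • (x - y))) := by
    intro y
    rcases le_or_gt r ‖x - y‖ with h | h
    · have h1 : ‖x - y‖ ^ (-(2 * α)) ≤ r ^ (-(2 * α)) :=
        Real.rpow_le_rpow_of_nonpos hrp h (by linarith)
      have h2 := hg0 (r⁻¹ • (x - y))
      gcongr
      have := mul_nonneg (Real.exp_pos (-r ^ 2 / (2 * s))).le h2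
      linarith
    · have h1 : g (r⁻¹ • (x - y)) = r⁻¹ ^ (-(2 * α)) * ‖x - y‖ ^ (-(2 * α)) := by
        rw [hgdef, Set.indicator_of_mem, norm_smul, Real.norm_of_nonneg (by positivity),
          Real.mul_rpow (by positivity) (by positivity)]
        rw [mem_ball_zero_iff, norm_smul, Real.norm_of_nonneg (by positivity),
          inv_mul_lt_iff₀ hrp]
        linarith
      have h2 : r ≤ ‖y‖ := by
        have := norm_sub_norm_le x y
        linarith
      have h3 : Real.exp (-‖y‖ ^ 2 / (2 * s)) ≤ Real.exp (-r ^ 2 / (2 * s)) := by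
        gcongr
      have h4 : r ^ (-(2 * α)) * r⁻¹ ^ (-(2 * α)) = 1 := by
        rw [← Real.mul_rpow (by positivity) (by positivity), mul_inv_cancel₀ hrp.ne',
          Real.one_rpow]
      rw [h1]
      calc _ ≤ ‖x - y‖ ^ (-(2 * α)) * Real.exp (-r ^ 2 / (2 * s)) := by gcongr
        _ = (r ^ (-(2 * α)) * r⁻¹ ^ (-(2 * α))) *
            (‖x - y‖ ^ (-(2 * α)) * Real.exp (-r ^ 2 / (2 * s))) := by rw [h4, one_mul]
        _ ≤ r ^ (-(2 * α)) * Real.exp (-‖y‖ ^ 2 / (2 * s)) + (r ^ (-(2 * α)) * r⁻¹ ^ (-(2 * α))) *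
            (‖x - y‖ ^ (-(2 * α)) * Real.exp (-r ^ 2 / (2 * s))) :=
          le_add_of_nonneg_left (by positivity)
        _ = _ := by ring
  have hint := integral_mono_of_nonneg (μ := volume)
    (Filter.Eventually.of_forall fun y => by positivity)
    ((heI.add (hgr.const_mul (Real.exp (-r ^ 2 / (2 * s))))).const_mul (r ^ (-(2 * α))))
    (Filter.Eventually.of_forall hpt)
  simp only [Pi.add_apply] at hint
  rw [integral_const_mul, integral_add heI (hgr.const_mul _), integral_const_mul, hei, hgi] at hint
  have hv := aux_v r s hrp hs
  have hc : (2 * Real.pi * s) ^ (-(3 / 2) : ℝ) * (2 * Real.pi * s) ^ (3 / 2 : ℝ) = 1 := by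
    rw [← Real.rpow_add (by positivity)]
    norm_num
  have hrr : r ^ (-(2 * α)) = ‖x‖ ^ (-(2 * α)) * (1 / 2 : ℝ) ^ (-(2 * α)) :=
    Real.mul_rpow (by positivity) (by positivity)
  calc _ ≤ (2 * Real.pi * s) ^ (-(3 / 2) : ℝ) * (r ^ (-(2 * α)) *
        ((2 * Real.pi * s) ^ (3 / 2 : ℝ) + Real.exp (-r ^ 2 / (2 * s)) * (r ^ 3 * K))) := by
        gcongr
    _ = r ^ (-(2 * α)) * ((2 * Real.pi * s) ^ (-(3 / 2) : ℝ) * (2 * Real.pi * s) ^ (3 / 2 : ℝ)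
        + ((2 * Real.pi * s) ^ (-(3 / 2) : ℝ) * r ^ 3 * Real.exp (-r ^ 2 / (2 * s))) * K) := by
        ring
    _ ≤ r ^ (-(2 * α)) * (1 + 3 * K) := by
        rw [hc]
        gcongr
    _ = _ := by rw [hrr]; ring
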